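/- Let (M,Q) be a nondegenerate finite quadratic module. There exists a group homomorphism ρ : SL₂(ℤ) → GL(ℂ[M]) satisfying ρ(T) = T_M and ρ(S) = S_M, where T = [1,1;0,1] and S = [0,−1;1,0], if and only if σ(M)⁴ = 1. (Such ρ is unique when it exists, since S and T generate SL₂(ℤ); this is the statement that the Weil representation of the metaplectic group factors through SL₂(ℤ) exactly when σ(M)⁴ = 1.) -/

import Mathlib

noncomputable section

/-- `ℚ/ℤ` as the additive circle of circumference 1. -/
abbrev QZ : Type := AddCircle (1 : ℚ)

lemma expPeriodic : Function.Periodic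
    (fun q : ℚ => Complex.exp (2 * Real.pi * Complex.I * (q : ℂ))) 1 := by
  intro x
  push_cast
  rw [mul_add, Complex.exp_add, mul_one, Complex.exp_two_pi_mul_I, mul_one]

/-- The standard character `e : ℚ/ℤ → ℂ`, `e(t) = exp(2πi t)`. -/
def ee : QZ → ℂ := expPeriodic.lift

variable {M : Type} [AddCommGroup M]

/-- The bilinear form associated to a quadratic form `Q : M → ℚ/ℤ`. -/
def Bf (Q : M → QZ) (x y : M) : QZ := Q (x + y) - Q x - Q y

/-- The Gauss sum `σ(M) = |M|^{-1/2} ∑_{x ∈ M} e(-Q(x))`. -/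
def gaussSigma (Q : M → QZ) : ℂ :=
  ((Real.sqrt (Nat.card M) : ℂ))⁻¹ * ∑ᶠ x : M, ee (-(Q x))

/-- The operator `T_M` of the Weil representation: `(T_M λ)(x) = e(Q(x))·λ(x)`. -/
def Tweil (Q : M → QZ) (lam : M → ℂ) : M → ℂ := fun x => ee (Q x) * lam x

/-- The operator `S_M` of the Weil representation:
`(S_M λ)(y) = σ(M)·|M|^{-1/2}·∑_{x∈M} e(-B(y,x))·λ(x)`. -/
def Sweil (Q : M → QZ) (lam : M → ℂ) : M → ℂ := fun y =>
  gaussSigma Q * ((Real.sqrt (Nat.card M) : ℂ))⁻¹ *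
    ∑ᶠ x : M, ee (-(Bf Q y x)) * lam x

/-- The `p`-primary component of an abelian group, as a subgroup. -/
def primaryComp (M : Type) [AddCommGroup M] (p : ℕ) : AddSubgroup M where
  carrier := {x | ∃ k : ℕ, (p ^ k : ℕ) • x = 0}
  zero_mem' := ⟨0, smul_zero _⟩
  add_mem' := by
    rintro a b ⟨k, hk⟩ ⟨l, hl⟩
    refine ⟨k + l, ?_⟩
    have ha : (p ^ (k + l) : ℕ) • a = 0 := by
      rw [pow_add, mul_comm, mul_smul, hk, smul_zero]
    have hb : (p ^ (k + l) : ℕ) • b = 0 := by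
      rw [pow_add, mul_smul, hl, smul_zero]
    rw [smul_add, ha, hb, add_zero]
  neg_mem' := by
    rintro a ⟨k, hk⟩
    exact ⟨k, by rw [smul_neg, hk, neg_zero]⟩

end

section Presentation
open Matrix

abbrev SLZ := Matrix.SpecialLinearGroup (Fin 2) ℤ

def mS : SLZ := ⟨!![0, -1; 1, 0], by norm_num [Matrix.det_fin_two_of]⟩
def mT : SLZ := ⟨!![1, 1; 0, 1], by norm_num [Matrix.det_fin_two_of]⟩
def mL : SLZ := ⟨!![1, 0; 1, 1], by norm_num [Matrix.det_fin_two_of]⟩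

def posM {K : Type*} [Group K] (A B : K) : Submonoid K :=
  Submonoid.closure {A ^ 3 * B, A ^ 3 * B ^ 2}

lemma normal_form {K : Type*} [Group K] (A B : K) (h4 : A ^ 4 = 1) (hz : B ^ 3 = A ^ 2)
    (h : K) (hh : h ∈ Subgroup.closure {A, B}) :
    ∃ i c : ℕ, ∃ p ∈ posM A B, h = B ^ i * p * A ^ c := by
  have stepB : ∀ h : K, (∃ i c : ℕ, ∃ p ∈ posM A B, h = B ^ i * p * A ^ c) →
      (∃ i c : ℕ, ∃ p ∈ posM A B, B * h = B ^ i * p * A ^ c) := by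
    rintro h ⟨i, c, p, hp, rfl⟩
    exact ⟨i + 1, c, p, hp, by rw [pow_succ']; group⟩
  have hcomm : ∀ q : ℕ, A * B ^ (3 * q) = B ^ (3 * q) * A := by
    intro q
    rw [pow_mul, hz]
    exact ((Commute.refl A).pow_right 2).pow_right q
  have stepA : ∀ h : K, (∃ i c : ℕ, ∃ p ∈ posM A B, h = B ^ i * p * A ^ c) →
      (∃ i c : ℕ, ∃ p ∈ posM A B, A * h = B ^ i * p * A ^ c) := by
    rintro h ⟨i, c, p, hp, rfl⟩
    have hAA : A ^ 2 * A ^ 3 = A := by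
      rw [← pow_add, show 2 + 3 = 4 + 1 from rfl, pow_add, h4]; simp
    have e1 : A * B = B ^ 3 * (A ^ 3 * B) := by
      rw [hz, ← mul_assoc, hAA]
    have e2 : A * B ^ 2 = B ^ 3 * (A ^ 3 * B ^ 2) := by
      rw [hz, ← mul_assoc, hAA]
    have hi : i = 3 * (i / 3) + i % 3 := by omega
    have hlt : i % 3 < 3 := Nat.mod_lt _ (by norm_num)
    generalize i / 3 = q at hi
    generalize i % 3 = r at hi hlt
    subst hi
    have e0 : A * (B ^ (3 * q + r) * p * A ^ c) = B ^ (3 * q) * (A * B ^ r * p) * A ^ c := by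
      rw [pow_add]
      simp only [← mul_assoc]
      rw [hcomm]
    rw [e0]
    interval_cases r
    · rw [pow_zero, mul_one]
      have : p = 1 ∨ ∃ p' ∈ posM A B, p = A ^ 3 * B * p' ∨ p = A ^ 3 * B ^ 2 * p' := by
        induction hp using Submonoid.closure_induction_left with
        | one => exact Or.inl rfl
        | mul_left x hx y hy ih =>
          right
          refine ⟨y, hy, ?_⟩
          rcases hx with rfl | rfl
          · exact Or.inl rfl
          · exact Or.inr rfl
      have h4' : A * A ^ 3 = 1 := by rw [← pow_succ', h4]
      rcases this with rfl | ⟨p', hp', rfl | rfl⟩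
      · exact ⟨3 * q, c + 1, 1, one_mem _, by rw [pow_succ']; group⟩
      · refine ⟨3 * q + 1, c, p', hp', ?_⟩
        simp only [← mul_assoc]
        rw [mul_assoc _ A (A ^ 3), h4', pow_succ, mul_one]
      · refine ⟨3 * q + 2, c, p', hp', ?_⟩
        simp only [← mul_assoc]
        rw [mul_assoc _ A (A ^ 3), h4', pow_add, mul_one]
    · refine ⟨3 * q + 3, c, (A ^ 3 * B) * p,
        mul_mem (Submonoid.subset_closure (by simp)) hp, ?_⟩
      rw [pow_one, e1, pow_add]
      simp only [← mul_assoc]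
    · refine ⟨3 * q + 3, c, (A ^ 3 * B ^ 2) * p,
        mul_mem (Submonoid.subset_closure (by simp)) hp, ?_⟩
      rw [e2, pow_add]
      simp only [← mul_assoc]
  have hAi : A⁻¹ = A * A * A := by
    rw [inv_eq_iff_mul_eq_one, ← h4]; simp only [pow_succ, pow_zero, one_mul, mul_assoc]
  have hB6 : B ^ 6 = 1 := by
    rw [show 6 = 3 * 2 from rfl, pow_mul, hz, ← pow_mul, h4]
  have hBi : B⁻¹ = B * B * B * B * B := by
    rw [inv_eq_iff_mul_eq_one, ← hB6]; simp only [pow_succ, pow_zero, one_mul, mul_assoc]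
  induction hh using Subgroup.closure_induction_left with
  | one => exact ⟨0, 0, 1, one_mem _, by simp⟩
  | mul_left x hx y hy ih =>
    rcases hx with rfl | rfl
    · exact stepA _ ih
    · exact stepB _ ih
  | inv_mul_cancel x hx y hy ih =>
    rcases hx with rfl | rfl
    · rw [hAi, mul_assoc, mul_assoc]; exact stepA _ (stepA _ (stepA _ ih))
    · rw [hBi, mul_assoc, mul_assoc, mul_assoc, mul_assoc]
      exact stepB _ (stepB _ (stepB _ (stepB _ (stepB _ ih))))

lemma mA3B : mS ^ 3 * (mS * mT) = mT := by decide
lemma mA3B2 : mS ^ 3 * (mS * mT) ^ 2 = mL := by decide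

lemma pos_prop {G : Type*} [Group G] (s t : G) (p : SLZ × G)
    (hp : p ∈ posM ((mS, s) : SLZ × G) ((mS, s) * (mT, t))) :
    (0 ≤ p.1.1 0 0 ∧ 0 ≤ p.1.1 0 1 ∧ 0 ≤ p.1.1 1 0 ∧ 0 ≤ p.1.1 1 1) ∧
      (p = 1 ∨ 0 < p.1.1 0 1 ∨ 0 < p.1.1 1 0) := by
  have key : (0 ≤ p.1.1 0 0 ∧ 0 ≤ p.1.1 0 1 ∧ 0 ≤ p.1.1 1 0 ∧ 0 ≤ p.1.1 1 1) ∧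
      (p = 1 ∨ 0 < p.1.1 0 1 ∨ 0 < p.1.1 1 0) ∧ 0 < p.1.1 0 0 ∧ 0 < p.1.1 1 1 := by
    induction hp using Submonoid.closure_induction_left with
    | one => simp
    | mul_left x hx y hy ih =>
      obtain ⟨⟨h1, h2, h3, h4⟩, -, h5, h6⟩ := ih
      rcases hx with rfl | rfl
      · have : ((mS, s) ^ 3 * ((mS, s) * (mT, t)) * y : SLZ × G).1 = mT * y.1 := by
          rw [← mA3B]; rfl
        simp only [this]
        simp only [Matrix.SpecialLinearGroup.coe_mul]
        simp [mT, Matrix.mul_apply, Fin.sum_univ_two]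
        refine ⟨⟨?_, ?_, ?_, ?_⟩, ?_, ?_, ?_⟩ <;> first | omega | (right; omega)
      · have : ((mS, s) ^ 3 * ((mS, s) * (mT, t)) ^ 2 * y : SLZ × G).1 = mL * y.1 := by
          rw [← mA3B2]; rfl
        simp only [this]
        simp only [Matrix.SpecialLinearGroup.coe_mul]
        simp [mL, Matrix.mul_apply, Fin.sum_univ_two]
        refine ⟨⟨?_, ?_, ?_, ?_⟩, ?_, ?_, ?_⟩ <;> first | omega | (right; omega)
  exact ⟨key.1, key.2.1⟩

lemma ker_triv {G : Type*} [Group G] (s t : G) (h4 : s ^ 4 = 1) (hz : (s * t) ^ 3 = s ^ 2)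
    (h : SLZ × G) (hh : h ∈ Subgroup.closure {((mS, s) : SLZ × G), (mS, s) * (mT, t)})
    (h1 : h.1 = 1) : h = 1 := by
  have hA4 : ((mS, s) : SLZ × G) ^ 4 = 1 := Prod.ext (by change mS ^ 4 = 1; decide) h4
  have hB3 : ((mS, s) * (mT, t) : SLZ × G) ^ 3 = (mS, s) ^ 2 :=
    Prod.ext (by change (mS * mT) ^ 3 = mS ^ 2; decide) hz
  have hB6 : ((mS, s) * (mT, t) : SLZ × G) ^ 6 = 1 := by
    rw [show 6 = 3 * 2 from rfl, pow_mul, hB3, ← pow_mul, hA4]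
  obtain ⟨i, c, p, hp, rfl⟩ := normal_form _ _ hA4 hB3 h hh
  rw [pow_eq_pow_mod i hB6, pow_eq_pow_mod c hA4] at h1 ⊢
  have hi : i % 6 < 6 := Nat.mod_lt _ (by norm_num)
  have hc : c % 4 < 4 := Nat.mod_lt _ (by norm_num)
  generalize i % 6 = i' at *
  generalize c % 4 = c' at *
  obtain ⟨⟨p1, p2, p3, p4⟩, p5⟩ := pos_prop s t p hp
  have hp1 : p.1 = ((mS * mT) ^ i')⁻¹ * (mS ^ c')⁻¹ := by
    rw [eq_mul_inv_iff_mul_eq, ← mul_left_cancel_iff (a := (mS * mT) ^ i'), mul_inv_cancel, ← mul_assoc]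
    exact h1
  rw [hp1] at p1 p2 p3 p4 p5
  interval_cases i' <;> interval_cases c' <;>
    first
    | exact absurd (And.intro p1 (And.intro p2 (And.intro p3 p4))) (by decide)
    | (rw [p5.resolve_right (by decide)]
       simp only [pow_zero, mul_one, hB3, ← pow_add, hA4])

theorem exists_hom {G : Type*} [Group G] (s t : G) (h4 : s ^ 4 = 1)
    (hz : (s * t) ^ 3 = s ^ 2) : ∃ ρ : SLZ →* G, ρ mT = t ∧ ρ mS = s := by
  let H : Subgroup (SLZ × G) := Subgroup.closure {((mS, s) : SLZ × G), (mS, s) * (mT, t)}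
  have hS : ((mS, s) : SLZ × G) ∈ H := Subgroup.subset_closure (by simp)
  have hT : ((mT, t) : SLZ × G) ∈ H := by
    have : ((mS, s) * (mT, t) : SLZ × G) ∈ H := Subgroup.subset_closure (by simp)
    exact (Subgroup.mul_mem_cancel_left H hS).1 this
  let π : H →* SLZ := (MonoidHom.fst SLZ G).comp H.subtype
  have hinj : Function.Injective π := by
    rw [injective_iff_map_eq_one]
    intro a ha
    exact Subtype.ext (ker_triv s t h4 hz a.1 a.2 ha)
  have hsurj : Function.Surjective π := by
    rw [← MonoidHom.range_eq_top, eq_top_iff, ← _root_.SpecialLinearGroup.SL2Z_generators,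
      Subgroup.closure_le]
    rintro x (rfl | rfl)
    · exact ⟨⟨_, hS⟩, rfl⟩
    · exact ⟨⟨_, hT⟩, rfl⟩
  let e := MulEquiv.ofBijective π ⟨hinj, hsurj⟩
  refine ⟨((MonoidHom.snd SLZ G).comp H.subtype).comp e.symm.toMonoidHom, ?_, ?_⟩
  · have : e.symm mT = ⟨_, hT⟩ := by rw [MulEquiv.symm_apply_eq]; rfl
    simp [this]
  · have : e.symm mS = ⟨_, hS⟩ := by rw [MulEquiv.symm_apply_eq]; rfl
    simp [this]

end Presentation

section Weil

lemma ee_coe (q : ℚ) : ee (q : QZ) = Complex.exp (2 * Real.pi * Complex.I * (q : ℂ)) := rfl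

lemma ee_zero : ee 0 = 1 := by
  have := ee_coe 0
  simpa using this

lemma ee_add (a b : QZ) : ee (a + b) = ee a * ee b := by
  induction a using QuotientAddGroup.induction_on with | H a => ?_
  induction b using QuotientAddGroup.induction_on with | H b => ?_
  have := ee_coe (a + b)
  rw [Rat.cast_add, mul_add, Complex.exp_add, ← ee_coe, ← ee_coe] at this
  exact this

lemma ee_eq_one (a : QZ) (h : ee a = 1) : a = 0 := by
  induction a using QuotientAddGroup.induction_on with | H a => ?_
  have h' : Complex.exp (2 * Real.pi * Complex.I * (a : ℂ)) = 1 := h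
  rw [Complex.exp_eq_one_iff] at h'
  obtain ⟨n, hn⟩ := h'
  rw [mul_comm] at hn
  have hn := mul_right_cancel₀ Complex.two_pi_I_ne_zero hn
  have : a = n := by exact_mod_cast hn
  refine (AddCircle.coe_eq_zero_iff (1 : ℚ)).2 ⟨n, by simp [this]⟩

variable {M : Type} [AddCommGroup M] [Fintype M] (Q : M → QZ)

lemma Bf_comm (x y : M) : Bf Q x y = Bf Q y x := by
  unfold Bf; rw [add_comm x y]; abel

lemma Q_add (x y : M) : Q (x + y) = Bf Q x y + Q x + Q y := by
  unfold Bf; abel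

variable (hquad : ∀ (n : ℤ) (x : M), Q (n • x) = (n ^ 2 : ℤ) • Q x)
    (hbil : ∀ x x' y : M, Bf Q (x + x') y = Bf Q x y + Bf Q x' y)
    (hnd : ∀ x : M, (∀ y : M, Bf Q x y = 0) → x = 0)

include hbil in
lemma Bf_add_right (x y y' : M) : Bf Q x (y + y') = Bf Q x y + Bf Q x y' := by
  rw [Bf_comm, hbil, Bf_comm Q y, Bf_comm Q y']

include hbil in
lemma Bf_zero_left (y : M) : Bf Q 0 y = 0 := by
  have := hbil 0 0 y
  simpa using this

include hbil in
lemma Bf_neg_left (x y : M) : Bf Q (-x) y = - Bf Q x y := by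
  have := hbil x (-x) y
  rw [add_neg_cancel, Bf_zero_left Q hbil] at this
  rw [eq_neg_iff_add_eq_zero, add_comm]; exact this.symm

include hbil hnd in
lemma orth [DecidableEq M] (y : M) :
    ∑ x : M, ee (Bf Q x y) = if y = 0 then (Fintype.card M : ℂ) else 0 := by
  let ψ : AddChar M ℂ :=
    { toFun := fun x => ee (Bf Q x y)
      map_zero_eq_one' := by rw [Bf_zero_left Q hbil, ee_zero]
      map_add_eq_mul' := by intro a b; rw [hbil, ee_add] }
  have h0 : ψ = 0 ↔ y = 0 := by
    constructor
    · intro h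
      apply hnd
      intro x
      rw [Bf_comm]
      apply ee_eq_one
      have : ψ x = 1 := by rw [h]; rfl
      exact this
    · rintro rfl
      ext x
      change ee (Bf Q x 0) = 1
      rw [Bf_comm, Bf_zero_left Q hbil, ee_zero]
  have := AddChar.sum_eq_ite ψ
  simp only [h0] at this
  exact this

include hbil hnd in
lemma orth_neg [DecidableEq M] (y : M) :
    ∑ x : M, ee (-Bf Q x y) = if y = 0 then (Fintype.card M : ℂ) else 0 := by
  rw [← orth Q hbil hnd y, ← Equiv.sum_comp (Equiv.neg M)]
  simp [Bf_neg_left Q hbil]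

include hquad in
lemma Q_zero : Q 0 = 0 := by simpa using hquad 0 0

include hquad in
lemma Q_neg (x : M) : Q (-x) = Q x := by simpa using hquad (-1) x

include hquad hbil hnd in
lemma gauss_mul : (∑ x : M, ee (-Q x)) * (∑ x : M, ee (Q x)) = Fintype.card M := by
  classical
  rw [Finset.sum_mul]
  have : ∀ x : M, ee (-Q x) * ∑ y : M, ee (Q y) = ∑ u : M, ee (Q u) * ee (Bf Q x u) := by
    intro x
    rw [Finset.mul_sum, ← Equiv.sum_comp (Equiv.addLeft x)]
    refine Finset.sum_congr rfl fun u _ => ?_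
    rw [← ee_add, ← ee_add, Equiv.coe_addLeft, Q_add Q]
    congr 1; abel
  simp_rw [this]
  rw [Finset.sum_comm]
  simp_rw [← Finset.mul_sum, orth Q hbil hnd]
  simp [Q_zero Q hquad, ee_zero]

lemma csq : ((Real.sqrt (Nat.card M) : ℂ))⁻¹ * ((Real.sqrt (Nat.card M) : ℂ))⁻¹
    * (Fintype.card M : ℂ) = 1 := by
  have h : ((Real.sqrt (Nat.card M) : ℂ)) * (Real.sqrt (Nat.card M) : ℂ) = Fintype.card M := by
    rw [← Complex.ofReal_mul, Real.mul_self_sqrt (Nat.cast_nonneg _)]; simp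
  have h0 : (Fintype.card M : ℂ) ≠ 0 := by simp
  rw [← mul_inv, h, inv_mul_cancel₀ h0]

lemma Sweil_eq (lam : M → ℂ) (y : M) : Sweil Q lam y =
    gaussSigma Q * ((Real.sqrt (Nat.card M) : ℂ))⁻¹ * ∑ x : M, ee (-(Bf Q y x)) * lam x := by
  unfold Sweil; rw [finsum_eq_sum_of_fintype]

include hbil hnd in
lemma S_sq (lam : M → ℂ) : Sweil Q (Sweil Q lam) = fun y => gaussSigma Q ^ 2 * lam (-y) := by
  classical
  ext y
  rw [Sweil_eq]
  simp_rw [Sweil_eq, Finset.mul_sum]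
  rw [Finset.sum_comm]
  set c := ((Real.sqrt (Nat.card M) : ℂ))⁻¹ with hc
  have : ∀ z : M, ∑ x : M, gaussSigma Q * c * (ee (-Bf Q y x) *
      (gaussSigma Q * c * (ee (-Bf Q x z) * lam z))) =
      gaussSigma Q ^ 2 * (c * c) * lam z * (if z = -y then (Fintype.card M : ℂ) else 0) := by
    intro z
    have e : (z = -y) ↔ y + z = 0 := by rw [eq_neg_iff_add_eq_zero, add_comm]
    simp only [e]
    rw [← orth_neg Q hbil hnd, Finset.mul_sum]
    refine Finset.sum_congr rfl fun x _ => ?_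
    rw [Bf_add_right Q hbil, neg_add, ee_add, Bf_comm Q y x]
    ring
  simp_rw [this]
  simp only [mul_ite, mul_zero, Finset.sum_ite_eq', Finset.mem_univ, if_true]
  have h := csq (M := M)
  rw [← hc] at h
  linear_combination (gaussSigma Q ^ 2 * lam (-y)) * h

include hquad hbil hnd in
lemma TSTST (lam : M → ℂ) :
    Tweil Q (Sweil Q (Tweil Q (Sweil Q (Tweil Q lam)))) = Sweil Q lam := by
  classical
  ext y
  unfold Tweil
  simp_rw [Sweil_eq, Finset.mul_sum]
  rw [Finset.sum_comm]
  refine Finset.sum_congr rfl fun z _ => ?_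
  set c := ((Real.sqrt (Nat.card M) : ℂ))⁻¹ with hc
  have hg : gaussSigma Q * c * ∑ x : M, ee (Q x) = 1 := by
    have h := csq (M := M)
    rw [← hc, ← gauss_mul Q hquad hbil hnd] at h
    rw [← h]
    unfold gaussSigma
    rw [finsum_eq_sum_of_fintype]
    ring
  have h2 : ∑ x : M, ee (Q x) = ∑ x : M, ee (Q (x + -(y + z))) :=
    (Equiv.sum_comp (Equiv.addRight (-(y + z))) (fun x => ee (Q x))).symm
  have h3 : ∀ x, ee (Q y) * (ee (-Bf Q y x) * (ee (Q x) * (ee (-Bf Q x z) * ee (Q z)))) =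
      ee (-Bf Q y z) * ee (Q (x + -(y + z))) := by
    intro x
    simp only [← ee_add]
    congr 1
    rw [Q_add Q x, Bf_comm Q x (-(y+z)), Bf_neg_left Q hbil, hbil, Q_neg Q hquad, Q_add Q y z,
      Bf_comm Q x z]
    abel
  calc _ = ∑ x : M, (gaussSigma Q * c) ^ 2 * lam z * (ee (Q y) * (ee (-Bf Q y x) * (ee (Q x) *
        (ee (-Bf Q x z) * ee (Q z))))) := Finset.sum_congr rfl fun x _ => by ring
    _ = (gaussSigma Q * c) ^ 2 * lam z * (ee (-Bf Q y z) * ∑ x : M, ee (Q x)) := by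
      simp_rw [h3]; rw [h2, ← Finset.mul_sum, ← Finset.mul_sum]
    _ = _ := by linear_combination (gaussSigma Q * c * lam z * ee (-Bf Q y z)) * hg

include hbil hnd in
lemma S_four (lam : M → ℂ) : Sweil Q (Sweil Q (Sweil Q (Sweil Q lam))) =
    gaussSigma Q ^ 4 • lam := by
  rw [S_sq Q hbil hnd, S_sq Q hbil hnd]
  ext y
  simp
  ring

noncomputable def Slin : (M → ℂ) →ₗ[ℂ] (M → ℂ) where
  toFun := Sweil Q
  map_add' a b := by
    ext y
    simp only [Sweil_eq, Pi.add_apply, mul_add, Finset.sum_add_distrib]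
  map_smul' a b := by
    ext y
    simp only [Sweil_eq, Pi.smul_apply, smul_eq_mul, RingHom.id_apply, Finset.mul_sum]
    exact Finset.sum_congr rfl fun x _ => by ring

noncomputable def Teq : (M → ℂ) ≃ₗ[ℂ] (M → ℂ) where
  toFun := Tweil Q
  invFun lam := fun x => ee (-Q x) * lam x
  map_add' a b := by ext y; simp [Tweil, mul_add]
  map_smul' a b := by ext y; simp [Tweil]; ring
  left_inv a := by
    ext y; simp only [Tweil]; rw [← mul_assoc, ← ee_add]; simp [ee_zero]
  right_inv a := by
    ext y; simp only [Tweil]; rw [← mul_assoc, ← ee_add]; simp [ee_zero]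

end Weil

/-- for a nondegenerate finite quadratic module `(M,Q)` there exists a
group homomorphism `ρ : SL₂(ℤ) → GL(ℂ[M])` with `ρ(T) = T_M` and `ρ(S) = S_M` if and
only if `σ(M)⁴ = 1`. -/
theorem weil_factors_through_SL2_iff {M : Type} [AddCommGroup M] [Finite M]
    (Q : M → QZ)
    (hquad : ∀ (n : ℤ) (x : M), Q (n • x) = (n ^ 2 : ℤ) • Q x)
    (hbil : ∀ x x' y : M, Bf Q (x + x') y = Bf Q x y + Bf Q x' y)
    (hnd : ∀ x : M, (∀ y : M, Bf Q x y = 0) → x = 0) :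
    (∃ ρ : Matrix.SpecialLinearGroup (Fin 2) ℤ →* ((M → ℂ) ≃ₗ[ℂ] (M → ℂ)),
      (∀ lam : M → ℂ,
        ρ ⟨!![1, 1; 0, 1], by norm_num [Matrix.det_fin_two_of]⟩ lam = Tweil Q lam) ∧
      (∀ lam : M → ℂ,
        ρ ⟨!![0, -1; 1, 0], by norm_num [Matrix.det_fin_two_of]⟩ lam = Sweil Q lam)) ↔
    gaussSigma Q ^ 4 = 1 := by
  have := Fintype.ofFinite M
  constructor
  · rintro ⟨ρ, -, hS⟩
    change ∀ lam, ρ mS lam = Sweil Q lam at hS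
    have h := S_four Q hbil hnd (fun _ => 1)
    have h4 : mS ^ 4 = 1 := by decide
    have h5 : (ρ mS) ^ 4 = 1 := by rw [← map_pow, h4, map_one]
    have h6 : ((ρ mS) ^ 4) (fun _ => 1) = (fun _ => (1 : ℂ)) := by rw [h5]; rfl
    simp only [pow_succ, pow_zero, one_mul, LinearEquiv.mul_apply, hS] at h6
    rw [h6] at h
    have := congrFun h 0
    simpa using this.symm
  · intro h
    have h4 : ∀ lam, Sweil Q (Sweil Q (Sweil Q (Sweil Q lam))) = lam := by
      intro lam; rw [S_four Q hbil hnd, h, one_smul]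
    let s : (M → ℂ) ≃ₗ[ℂ] (M → ℂ) :=
      { Slin Q with
        invFun := fun lam => Sweil Q (Sweil Q (Sweil Q lam))
        left_inv := fun lam => h4 lam
        right_inv := fun lam => h4 lam }
    have hs : ∀ lam, s lam = Sweil Q lam := fun _ => rfl
    have ht : ∀ lam, Teq Q lam = Tweil Q lam := fun _ => rfl
    obtain ⟨ρ, h1, h2⟩ := exists_hom s (Teq Q)
      (by
        apply LinearEquiv.ext
        intro lam
        simp only [pow_succ, pow_zero, one_mul, LinearEquiv.mul_apply, hs]
        exact h4 lam)
      (by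
        apply LinearEquiv.ext
        intro lam
        simp only [pow_succ, pow_zero, one_mul, LinearEquiv.mul_apply, hs, ht]
        rw [TSTST Q hquad hbil hnd])
    refine ⟨ρ, fun lam => ?_, fun lam => ?_⟩
    · change ρ mT lam = _
      rw [h1, ht]
    · change ρ mS lam = _
      rw [h2, hs]
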